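/- Let m ≥ 1, let d and N be integers with 1 ≤ d ≤ N, let a_d, …, a_N be complex numbers, and let s be an integer with s ≥ 1 − d. Let x_1, …, x_m be pairwise distinct complex numbers. Then Σ_{i=d}^{N} a_i · h_{i−m+s}(x_1, …, x_m) = Σ_{i=1}^{m} (Σ_{l=d}^{N} a_l x_i^{s+l−1}) / ∏_{j ≠ i} (x_i − x_j), where h_k denotes the complete homogeneous symmetric polynomial of degree k in m variables, with the conventions h_0 = 1 and h_k = 0 for k < 0 (note s + l − 1 ≥ 0 for all l ≥ d, so all exponents are nonnegative). -/

import Mathlib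

open scoped BigOperators

/-- The complete homogeneous symmetric polynomial of degree `n` in the `m` complex
numbers `x 0, …, x (m-1)`: the sum of all monomials of total degree `n`. -/
noncomputable def completeHomogeneous {m : ℕ} (x : Fin m → ℂ) (n : ℕ) : ℂ :=
  ∑ μ ∈ Finset.Nat.antidiagonalTuple m n, ∏ i, x i ^ μ i

/-- `h_k` for an integer index `k`, with the convention `h_k = 0` for `k < 0`. -/
noncomputable def completeHomogeneousZ {m : ℕ} (x : Fin m → ℂ) (k : ℤ) : ℂ :=
  if k < 0 then 0 else completeHomogeneous x k.toNat

theorem completeHomogeneous_zero {m : ℕ} (x : Fin m → ℂ) : completeHomogeneous x 0 = 1 := by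
  simp [completeHomogeneous, Finset.Nat.antidiagonalTuple_zero_right]

theorem completeHomogeneous_eq_sum_antidiagonal {m : ℕ} (x : Fin (m + 1) → ℂ) (n : ℕ) :
    completeHomogeneous x n =
      ∑ p ∈ Finset.HasAntidiagonal.antidiagonal n, x 0 ^ p.1 * completeHomogeneous (Fin.tail x) p.2 := by
  simp only [completeHomogeneous, Finset.mul_sum]
  rw [Finset.sum_sigma']
  refine Finset.sum_bij' (fun μ _ => ⟨(μ 0, ∑ i : Fin m, μ i.succ), Fin.tail μ⟩)
    (fun q _ => Fin.cons q.1.1 q.2) ?_ ?_ ?_ ?_ ?_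
  · intro μ hμ
    simpa [Finset.Nat.mem_antidiagonalTuple, Fin.sum_univ_succ, Fin.tail] using hμ
  · rintro ⟨⟨a, b⟩, ν⟩ h
    simp only [Finset.mem_sigma, Finset.HasAntidiagonal.mem_antidiagonal,
      Finset.Nat.mem_antidiagonalTuple] at h
    simp [Finset.Nat.mem_antidiagonalTuple, Fin.sum_univ_succ, h.1, h.2]
  · intro μ _
    simp
  · rintro ⟨⟨a, b⟩, ν⟩ h
    simp only [Finset.mem_sigma, Finset.HasAntidiagonal.mem_antidiagonal,
      Finset.Nat.mem_antidiagonalTuple] at h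
    simp [h.2]
  · intro μ _
    simp [Fin.prod_univ_succ, Fin.tail]

theorem completeHomogeneous_succ {m : ℕ} (x : Fin (m + 1) → ℂ) (n : ℕ) :
    completeHomogeneous x (n + 1) =
      x 0 * completeHomogeneous x n + completeHomogeneous (Fin.tail x) (n + 1) := by
  simp only [completeHomogeneous_eq_sum_antidiagonal x, Finset.Nat.sum_antidiagonal_succ,
    Finset.mul_sum, pow_succ', pow_zero, one_mul, mul_assoc]
  ring

theorem completeHomogeneousZ_natCast {m : ℕ} (x : Fin m → ℂ) (n : ℕ) :
    completeHomogeneousZ x n = completeHomogeneous x n := by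
  simp [completeHomogeneousZ]

theorem completeHomogeneousZ_of_neg {m : ℕ} (x : Fin m → ℂ) {k : ℤ} (hk : k < 0) :
    completeHomogeneousZ x k = 0 := if_pos hk

theorem completeHomogeneousZ_add_one {m : ℕ} (x : Fin (m + 1) → ℂ) (k : ℤ) :
    completeHomogeneousZ x (k + 1) =
      x 0 * completeHomogeneousZ x k + completeHomogeneousZ (Fin.tail x) (k + 1) := by
  rcases lt_trichotomy k (-1) with hk | rfl | hk
  · simp [completeHomogeneousZ_of_neg, show k + 1 < 0 by omega, show k < 0 by omega]
  · simp [completeHomogeneousZ, completeHomogeneous_zero]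
  · lift k to ℕ using by omega
    exact_mod_cast completeHomogeneous_succ x k

/-- The divided difference of `t ↦ t ^ (p + 1)` at the nodes `x 0, …, x m`, expressed through the
divided differences of `t ↦ t ^ p`. -/
theorem sum_pow_succ_div_prod_sub {m : ℕ} (x : Fin (m + 1) → ℂ) (hx : Function.Injective x)
    (p : ℕ) :
    ∑ i, x i ^ (p + 1) / ∏ j ∈ Finset.univ.erase i, (x i - x j) =
      x 0 * ∑ i, x i ^ p / ∏ j ∈ Finset.univ.erase i, (x i - x j) +
        ∑ i, Fin.tail x i ^ p /
          ∏ j ∈ Finset.univ.erase i, (Fin.tail x i - Fin.tail x j) := by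
  have herase (i : Fin m) : ∏ j ∈ Finset.univ.erase i.succ, (x i.succ - x j) =
      (x i.succ - x 0) * ∏ j ∈ Finset.univ.erase i, (Fin.tail x i - Fin.tail x j) := by
    have h0 : (0 : Fin (m + 1)) ∉ (Finset.univ.erase i).map (Fin.succEmb m) := by simp
    have : Finset.univ.erase i.succ =
        Finset.cons 0 ((Finset.univ.erase i).map (Fin.succEmb m)) h0 := by
      ext j
      cases j using Fin.cases <;> simp [Fin.succ_ne_zero, (Fin.succ_ne_zero _).symm]
    rw [this, Finset.prod_cons, Finset.prod_map]
    rfl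
  rw [← sub_eq_iff_eq_add', Finset.mul_sum, ← Finset.sum_sub_distrib, Fin.sum_univ_succ]
  have h0 : x 0 ^ (p + 1) / ∏ j ∈ Finset.univ.erase 0, (x 0 - x j) -
      x 0 * (x 0 ^ p / ∏ j ∈ Finset.univ.erase 0, (x 0 - x j)) = 0 := by ring
  rw [h0, zero_add]
  refine Finset.sum_congr rfl fun i _ => ?_
  have hne : x i.succ - x 0 ≠ 0 := sub_ne_zero.2 (hx.ne (Fin.succ_ne_zero i))
  rw [herase, ← mul_div_assoc, ← sub_div, pow_succ', ← sub_mul, mul_div_mul_left _ _ hne]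
  rfl

theorem sum_inv_prod_sub {m : ℕ} (x : Fin (m + 1) → ℂ) (hx : Function.Injective x) :
    ∑ i, 1 / ∏ j ∈ Finset.univ.erase i, (x i - x j) = if m = 0 then 1 else 0 := by
  have h := Lagrange.coeff_eq_sum (s := Finset.univ) (v := x) hx.injOn (P := 1)
    (by rw [Polynomial.degree_one, Finset.card_fin]; exact_mod_cast m.succ_pos)
  simpa [Polynomial.coeff_one] using h.symm

/-- The divided difference of `t ↦ t ^ p` at distinct nodes `x 0, …, x (m - 1)` is
the complete homogeneous symmetric polynomial of degree `p + 1 - m` in the nodes. -/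
theorem completeHomogeneousZ_eq_sum_pow_div {m : ℕ} (x : Fin m → ℂ)
    (hx : Function.Injective x) (p : ℕ) :
    completeHomogeneousZ x ((p : ℤ) + 1 - m) =
      ∑ i, x i ^ p / ∏ j ∈ Finset.univ.erase i, (x i - x j) := by
  induction m generalizing p with
  | zero =>
    have h : completeHomogeneousZ x ((p + 1 : ℕ) : ℤ) = 0 := by
      rw [completeHomogeneousZ_natCast]
      simp [completeHomogeneous]
    simpa using h
  | succ m ihm =>
    induction p with
    | zero =>
      simp only [pow_zero]
      rw [sum_inv_prod_sub x hx]
      split_ifs with hm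
      · subst hm
        simp [completeHomogeneousZ, completeHomogeneous_zero]
      · exact completeHomogeneousZ_of_neg x (by push_cast; omega)
    | succ p ihp =>
      have htail : Function.Injective (Fin.tail x) := hx.comp (Fin.succ_injective m)
      rw [sum_pow_succ_div_prod_sub x hx, ← ihp, ← ihm _ htail]
      have h := completeHomogeneousZ_add_one x ((p : ℤ) + 1 - (m + 1 : ℕ))
      convert h using 2 <;> [skip; congr 1] <;> push_cast <;> ring

/-- For `1 ≤ d ≤ N`, complex numbers `a_d, …, a_N`, an integer `s ≥ 1-d`, and pairwise
distinct complex numbers `x_1, …, x_m`: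
`Σ_{i=d}^N a_i h_{i-m+s}(x) = Σ_{i=1}^m (Σ_{l=d}^N a_l x_i^{s+l-1}) / ∏_{j≠i}(x_i-x_j)`. -/
theorem stmt_19 (m : ℕ) (hm : 1 ≤ m) (d N : ℕ) (hd : 1 ≤ d) (hdN : d ≤ N)
    (a : ℕ → ℂ) (s : ℤ) (hs : 1 - (d : ℤ) ≤ s) (x : Fin m → ℂ)
    (hx : Function.Injective x) :
    ∑ i ∈ Finset.Icc d N, a i * completeHomogeneousZ x ((i : ℤ) - m + s)
      = ∑ i : Fin m,
          (∑ l ∈ Finset.Icc d N, a l * x i ^ (s + l - 1)) /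
            ∏ j ∈ Finset.univ.erase i, (x i - x j) := by
  simp only [Finset.sum_div]
  rw [Finset.sum_comm]
  refine Finset.sum_congr rfl fun l hl => ?_
  have hdl := (Finset.mem_Icc.1 hl).1
  obtain ⟨p, hp⟩ := Int.eq_ofNat_of_zero_le (show 0 ≤ s + l - 1 by omega)
  rw [hp, show (l : ℤ) - m + s = p + 1 - m by omega,
    completeHomogeneousZ_eq_sum_pow_div x hx, Finset.mul_sum]
  simp only [zpow_natCast, mul_div_assoc]
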